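/- Let A ⊂ ([n] choose a) and B ⊂ ([n] choose b) be cross-intersecting with a + b ≤ n, and let c > 0. Then |A| + c|B| ≤ max{ binom(n,a), c*binom(n,b) }. -/

import Mathlib

open Finset in
/-- The normalized sizes of two uniform cross-intersecting families sum to at most one: the first
family together with the complements of the second is an antichain. -/
theorem card_div_choose_add_card_div_choose_le_one_of_crossIntersecting {n a b : ℕ}
    (hab : a + b ≤ n) {A B : Finset (Finset (Fin n))}
    (hA : ∀ S ∈ A, S.card = a) (hB : ∀ T ∈ B, T.card = b)
    (hcross : ∀ S ∈ A, ∀ T ∈ B, (S ∩ T).Nonempty) :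
    (A.card : ℝ) / n.choose a + (B.card : ℝ) / n.choose b ≤ 1 := by
  classical
  have not_subset_compl : ∀ S ∈ A, ∀ T ∈ B, ¬ S ⊆ Tᶜ := fun S hS T hT h =>
    not_disjoint_iff_nonempty_inter.2 (hcross S hS T hT) (subset_compl_iff_disjoint_right.1 h)
  have card_compl_of_mem : ∀ T ∈ B, Tᶜ.card = n - b := fun T hT => by
    rw [card_compl, Fintype.card_fin, hB T hT]
  have hdisj : Disjoint A (B.image compl) := by
    rw [disjoint_left]
    intro S hS hS'
    obtain ⟨T, hT, rfl⟩ := mem_image.1 hS'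
    exact not_subset_compl _ hS T hT Subset.rfl
  have hanti : IsAntichain (· ⊆ ·) (SetLike.coe (A ∪ B.image compl)) := by
    intro S hS T hT hne hST
    rw [SetLike.mem_coe, mem_union, mem_image] at hS hT
    have eq_of_card_le : T.card ≤ S.card → False := fun h => hne (eq_of_subset_of_card_le hST h)
    rcases hS with hS | ⟨S, hS, rfl⟩ <;> rcases hT with hT | ⟨T, hT, rfl⟩
    · exact eq_of_card_le (by rw [hA S hS, hA T hT])
    · exact not_subset_compl S hS T hT hST
    · exact eq_of_card_le (by rw [card_compl_of_mem S hS, hA T hT]; omega)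
    · exact eq_of_card_le (by rw [card_compl_of_mem S hS, card_compl_of_mem T hT])
  have hlym := lubell_yamamoto_meshalkin_inequality_sum_inv_choose (𝕜 := ℝ) hanti
  rw [sum_union hdisj, sum_image compl_injective.injOn, Fintype.card_fin,
    sum_congr rfl fun S hS => by rw [hA S hS],
    sum_congr (s₁ := B) rfl fun T hT => by
      rw [card_compl_of_mem T hT, Nat.choose_symm (by omega)]] at hlym
  simpa [div_eq_mul_inv] using hlym

theorem stmt_15 (n a b : ℕ) (hab : a + b ≤ n) (c : ℝ) (hc : 0 < c)
    (A B : Finset (Finset (Fin n)))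
    (hA : ∀ S ∈ A, S.card = a) (hB : ∀ T ∈ B, T.card = b)
    (hcross : ∀ S ∈ A, ∀ T ∈ B, (S ∩ T).Nonempty) :
    (A.card : ℝ) + c * B.card ≤ max (n.choose a : ℝ) (c * n.choose b) := by
  have hsum := card_div_choose_add_card_div_choose_le_one_of_crossIntersecting hab hA hB hcross
  have ha : (0 : ℝ) < n.choose a := by exact_mod_cast Nat.choose_pos (by omega)
  have hb : (0 : ℝ) < n.choose b := by exact_mod_cast Nat.choose_pos (by omega)
  set M := max (n.choose a : ℝ) (c * n.choose b)
  calc (A.card : ℝ) + c * B.card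
      = A.card / n.choose a * n.choose a + B.card / n.choose b * (c * n.choose b) := by
        field_simp
    _ ≤ A.card / n.choose a * M + B.card / n.choose b * M := by
        gcongr
        exacts [le_max_left _ _, le_max_right _ _]
    _ = (A.card / n.choose a + B.card / n.choose b) * M := by ring
    _ ≤ M := mul_le_of_le_one_left (ha.le.trans (le_max_left _ _)) hsum
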